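/- Let G be a C^∞ function on a neighborhood U of 0 in ℝⁿ (n ≥ 1), and let p : ℝ × S^{n−1} → ℝⁿ be the polar blow-down map p(t, u) = t·u, where S^{n−1} ⊂ ℝⁿ is the unit sphere. Then G is flat at 0 if and only if the C^∞ function G̃ = G ∘ p on the open set p⁻¹(U) ⊆ ℝ × S^{n−1} is flat at every point of the exceptional set {0} × S^{n−1}. The same equivalence holds componentwise for a C^∞ vector field Z on U: Z is flat at 0 if and only if each component function of Z ∘ p is flat at every point of {0} × S^{n−1}. -/

import Mathlib

open scoped Manifold ContDiff

noncomputable section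

/-- A map between real normed spaces is flat at a point if it and all its derivatives of
every order vanish there. -/
def FlatAt {E F' : Type*} [NormedAddCommGroup E] [NormedSpace ℝ E] [NormedAddCommGroup F']
    [NormedSpace ℝ F'] (f : E → F') (p : E) : Prop :=
  ∀ k : ℕ, iteratedFDeriv ℝ k f p = 0

/-- The polar blow-down map `p : ℝ × S^{n−1} → ℝⁿ`, `p(t, u) = t·u`, where `n = d + 1`. -/
def blowDown (d : ℕ) (z : ℝ × Metric.sphere (0 : EuclideanSpace ℝ (Fin (d + 1))) 1) :
    EuclideanSpace ℝ (Fin (d + 1)) :=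
  z.1 • (z.2 : EuclideanSpace ℝ (Fin (d + 1)))

/-- A function on the smooth manifold `ℝ × S^{n−1}` (`n = d + 1`), defined and smooth on
an open set `D`, is flat at a point `z ∈ D` if, read in the smooth chart `extChartAt z`,
it and all its derivatives of every order vanish at the point corresponding to `z`. -/
def MFlatAt (d : ℕ)
    (f : ℝ × Metric.sphere (0 : EuclideanSpace ℝ (Fin (d + 1))) 1 → ℝ)
    (D : Set (ℝ × Metric.sphere (0 : EuclideanSpace ℝ (Fin (d + 1))) 1))
    (z : ℝ × Metric.sphere (0 : EuclideanSpace ℝ (Fin (d + 1))) 1) : Prop :=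
  ∀ k : ℕ, iteratedFDerivWithin ℝ k
    (f ∘ (extChartAt ((𝓘(ℝ, ℝ)).prod (𝓡 d)) z).symm)
    ((extChartAt ((𝓘(ℝ, ℝ)).prod (𝓡 d)) z).target ∩
      (extChartAt ((𝓘(ℝ, ℝ)).prod (𝓡 d)) z).symm ⁻¹' D)
    (extChartAt ((𝓘(ℝ, ℝ)).prod (𝓡 d)) z z) = 0

section Flat

variable {E F H : Type*} [NormedAddCommGroup E] [NormedSpace ℝ E] [NormedAddCommGroup F]
  [NormedSpace ℝ F] [NormedAddCommGroup H] [NormedSpace ℝ H]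

/-- Flatness is preserved by precomposition with a smooth map. -/
theorem FlatAt.comp {g : F → H} {f : E → F} {x : E} {y : F} (h : FlatAt g y)
    (hy : f x = y) (hg : ContDiffAt ℝ ∞ g y) (hf : ContDiffAt ℝ ∞ f x) : FlatAt (g ∘ f) x := by
  subst hy
  intro k
  obtain ⟨t, ht, hgt⟩ := (hg.of_le (m := k) (by exact_mod_cast le_top)).contDiffOn
    (m := k) le_rfl (by simp)
  obtain ⟨s, hs, hfs⟩ := (hf.of_le (m := k) (by exact_mod_cast le_top)).contDiffOn
    (m := k) le_rfl (by simp)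
  obtain ⟨t', ht't, ht'o, hxt'⟩ := mem_nhds_iff.1 ht
  obtain ⟨s', hs's, hs'o, hxs'⟩ :=
    mem_nhds_iff.1 (Filter.inter_mem hs (hf.continuousAt.preimage_mem_nhds
      (ht'o.mem_nhds hxt')))
  set D : ℝ := 1 + ∑ i ∈ Finset.range (k + 1), ‖iteratedFDeriv ℝ i f x‖ with hD
  have hsum : 0 ≤ ∑ i ∈ Finset.range (k + 1), ‖iteratedFDeriv ℝ i f x‖ :=
    Finset.sum_nonneg fun _ _ => norm_nonneg _
  have key := norm_iteratedFDerivWithin_comp_le (x := x) (C := 0) (D := D) (n := k)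
    (hgt.mono ht't) (hfs.mono fun y hy => (hs's hy).1) le_rfl ht'o.uniqueDiffOn
    hs'o.uniqueDiffOn (fun y hy => (hs's hy).2) hxs'
    (fun i _ => by rw [iteratedFDerivWithin_of_isOpen i ht'o hxt', h i, norm_zero])
    (fun i hi hik => by
      rw [iteratedFDerivWithin_of_isOpen i hs'o hxs']
      have h1 : ‖iteratedFDeriv ℝ i f x‖ ≤ D :=
        (Finset.single_le_sum (f := fun i => ‖iteratedFDeriv ℝ i f x‖)
          (fun _ _ => norm_nonneg _) (Finset.mem_range.2 (Nat.lt_succ_of_le hik))).trans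
          (by linarith)
      exact h1.trans (le_self_pow₀ (by linarith) (by omega)))
  rw [iteratedFDerivWithin_of_isOpen k hs'o hxs', mul_zero, zero_mul] at key
  exact norm_le_zero_iff.1 key

/-- The iterated derivative of a smooth function is invariant under adjacent transpositions. -/
theorem ContDiffOn.iteratedFDeriv_comp_swap {f : E → F} {U : Set E} (hU : IsOpen U)
    (hf : ContDiffOn ℝ ∞ f U) (n : ℕ) :
    ∀ {x : E}, x ∈ U → ∀ (i : Fin n) (v : Fin (n + 1) → E),
      iteratedFDeriv ℝ (n + 1) f x (v ∘ Equiv.swap i.castSucc i.succ) =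
        iteratedFDeriv ℝ (n + 1) f x v := by
  induction n with
  | zero => intro x _ i; exact i.elim0
  | succ n ih =>
    intro x hx i v
    have hsmooth (m : ℕ) : ContDiffAt ℝ ∞ (iteratedFDeriv ℝ m f) x :=
      (hf.contDiffAt (hU.mem_nhds hx)).iteratedFDeriv_right (m := ∞) (by norm_cast)
    have happly (w : Fin (n + 1) → E) (a : E) :
        fderiv ℝ (iteratedFDeriv ℝ (n + 1) f) x a w =
          fderiv ℝ (fun y => iteratedFDeriv ℝ (n + 1) f y w) x a := by
      have hd : DifferentiableAt ℝ (iteratedFDeriv ℝ (n + 1) f) x :=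
        (hsmooth (n + 1)).differentiableAt (by simp)
      have := ((ContinuousMultilinearMap.apply ℝ (fun _ : Fin (n + 1) => E) F w).hasFDerivAt.comp
        x hd.hasFDerivAt).fderiv
      exact (congrArg (fun L => L a) this).symm
    induction i using Fin.cases with
    | zero =>
      have hsymm : IsSymmSndFDerivAt ℝ (iteratedFDeriv ℝ n f) x :=
        (hsmooth n).isSymmSndFDerivAt (by
          simp only [minSmoothness_of_isRCLikeNormedField]
          exact WithTop.coe_le_coe.2 le_top)
      have expand (w : Fin (n + 2) → E) : iteratedFDeriv ℝ (n + 2) f x w =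
          fderiv ℝ (fderiv ℝ (iteratedFDeriv ℝ n f)) x (w 0) (w 1) (fun j => w j.succ.succ) := by
        have hd : DifferentiableAt ℝ (fderiv ℝ (iteratedFDeriv ℝ n f)) x :=
          ((hsmooth n).fderiv_right (m := 1) (by norm_cast)).differentiableAt one_ne_zero
        have hc := ((ContinuousMultilinearMap.apply ℝ (fun _ : Fin n => E) F
          (Fin.tail (Fin.tail w))).hasFDerivAt.comp x
            (hd.hasFDerivAt.clm_apply (hasFDerivAt_const (Fin.tail w 0) x))).fderiv
        rw [iteratedFDeriv_succ_apply_left, happly (Fin.tail w)]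
        refine (congrArg (fun L => L (w 0)) hc).trans ?_
        simp [Fin.tail_def]
      rw [expand, expand, hsymm.eq]
      congr 2
    | succ j =>
      have htail : Fin.tail (v ∘ Equiv.swap j.succ.castSucc j.succ.succ) =
          Fin.tail v ∘ Equiv.swap j.castSucc j.succ := by
        funext l
        simp only [Fin.tail, Function.comp_apply]
        rw [Fin.castSucc_succ, (Fin.succ_injective _).swap_apply]
      have hzero : (v ∘ Equiv.swap j.succ.castSucc j.succ.succ) 0 = v 0 := by
        rw [Function.comp_apply, Equiv.swap_apply_of_ne_of_ne]
        · rw [Fin.castSucc_succ]; exact (Fin.succ_ne_zero _).symm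
        · exact (Fin.succ_ne_zero _).symm
      rw [iteratedFDeriv_succ_apply_left, iteratedFDeriv_succ_apply_left, hzero, htail,
        happly, happly]
      congr 1
      apply Filter.EventuallyEq.fderiv_eq
      filter_upwards [hU.mem_nhds hx] with y hy
      exact ih hy j (Fin.tail v)

/-- The iterated derivative of a smooth function is symmetric. -/
theorem ContDiffOn.iteratedFDeriv_comp_perm {f : E → F} {U : Set E} (hU : IsOpen U)
    (hf : ContDiffOn ℝ ∞ f U) {x : E} (hx : x ∈ U) {n : ℕ} (σ : Equiv.Perm (Fin n))
    (v : Fin n → E) :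
    iteratedFDeriv ℝ n f x (v ∘ σ) = iteratedFDeriv ℝ n f x v := by
  cases n with
  | zero => exact congrArg _ (Subsingleton.elim _ _)
  | succ n =>
    have hσ : σ ∈ Submonoid.closure
        (Set.range fun i : Fin n => Equiv.swap i.castSucc i.succ) := by
      rw [Equiv.Perm.mclosure_swap_castSucc_succ]; trivial
    induction hσ using Submonoid.closure_induction generalizing v with
    | mem τ hτ =>
      obtain ⟨i, rfl⟩ := hτ
      exact hf.iteratedFDeriv_comp_swap hU n hx i v
    | one => rfl
    | mul τ ρ _ _ hτ hρ =>
      rw [Equiv.Perm.coe_mul, ← Function.comp_assoc, hρ, hτ]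

/-- A symmetric multilinear map vanishing on the diagonal is zero. -/
theorem ContinuousMultilinearMap.eq_zero_of_diagonal {n : ℕ} (f : E [×n]→L[ℝ] F)
    (hsymm : ∀ (σ : Equiv.Perm (Fin n)) (v : Fin n → E), f (v ∘ σ) = f v)
    (hdiag : ∀ v : E, f (fun _ => v) = 0) : f = 0 := by
  ext v
  have h := f.iteratedFDeriv_comp_diagonal 0 v
  have hz : (fun x => f (fun _ => x)) = fun _ : E => (0 : F) := funext hdiag
  have hs (σ : Equiv.Perm (Fin n)) : f (fun i => v (σ i)) = f v := hsymm σ v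
  simp only [hz, hs, iteratedFDeriv_fun_zero, Finset.sum_const, Finset.card_univ] at h
  have hc : Fintype.card (Equiv.Perm (Fin n)) ≠ 0 := Fintype.card_ne_zero
  rw [← Nat.cast_smul_eq_nsmul ℝ] at h
  exact (smul_eq_zero.1 h.symm).resolve_left (by exact_mod_cast hc)

/-- A smooth function is flat at the origin as soon as its restriction to every line spanned by a
unit vector is. -/
theorem flatAt_zero_of_forall_line [Nontrivial E] {f : E → F} {U : Set E} (hU : IsOpen U)
    (h0 : (0 : E) ∈ U) (hf : ContDiffOn ℝ ∞ f U)
    (h : ∀ u : E, ‖u‖ = 1 → FlatAt (fun t : ℝ => f (t • u)) 0) : FlatAt f 0 := by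
  intro k
  refine ContinuousMultilinearMap.eq_zero_of_diagonal _
    (fun σ v => hf.iteratedFDeriv_comp_perm hU h0 σ v) fun v => ?_
  obtain ⟨r, u, hu, rfl⟩ : ∃ (r : ℝ) (u : E), ‖u‖ = 1 ∧ r • u = v := by
    rcases eq_or_ne v 0 with rfl | hv
    · obtain ⟨u, hu⟩ := exists_norm_eq E zero_le_one
      exact ⟨0, u, hu, zero_smul _ _⟩
    · exact ⟨‖v‖, ‖v‖⁻¹ • v, norm_smul_inv_norm hv, by
        rw [smul_smul, mul_inv_cancel₀ (norm_ne_zero_iff.2 hv), one_smul]⟩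
  let L : ℝ →L[ℝ] E := ContinuousLinearMap.toSpanSingleton ℝ u
  have hL0 : L 0 ∈ U := by simpa using h0
  have hLU : IsOpen (L ⁻¹' U) := hU.preimage L.continuous
  have key := L.iteratedFDerivWithin_comp_right hf hU.uniqueDiffOn hLU.uniqueDiffOn hL0
    (i := k) (by exact_mod_cast le_top)
  rw [iteratedFDerivWithin_of_isOpen k hLU hL0, iteratedFDerivWithin_of_isOpen k hU hL0,
    map_zero] at key
  have hz : iteratedFDeriv ℝ k (f ∘ L) 0 = 0 := h u hu k
  have := congrArg (fun M => M (fun _ => r)) (key.symm.trans hz)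
  simpa [L] using this

/-- A map into Euclidean space is flat at a point iff all its components are. -/
theorem flatAt_euclidean_iff {ι : Type*} [Fintype ι] {Z : E → EuclideanSpace ℝ ι} {x : E}
    (hZ : ContDiffAt ℝ ∞ Z x) : FlatAt Z x ↔ ∀ j, FlatAt (fun y => Z y j) x := by
  have hcomp (j : ι) (k : ℕ) : iteratedFDeriv ℝ k (fun y => Z y j) x =
      (EuclideanSpace.proj (𝕜 := ℝ) j).compContinuousMultilinearMap (iteratedFDeriv ℝ k Z x) :=
    (EuclideanSpace.proj (𝕜 := ℝ) j).iteratedFDeriv_comp_left hZ (by exact_mod_cast le_top)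
  constructor
  · intro h j k
    rw [hcomp, h k]
    ext v
    simp
  · intro h k
    ext v j
    have := congrArg (fun M => M v) ((hcomp j k).symm.trans (h j k))
    simpa using this

end Flat

section BlowDown

variable {d : ℕ}

theorem contMDiff_blowDown :
    ContMDiff ((𝓘(ℝ, ℝ)).prod (𝓡 d)) 𝓘(ℝ, EuclideanSpace ℝ (Fin (d + 1))) ∞ (blowDown d) :=
  haveI : Fact (Module.finrank ℝ (EuclideanSpace ℝ (Fin (d + 1))) = d + 1) := ⟨by simp⟩
  contMDiff_fst.smul ((contMDiff_coe_sphere (E := EuclideanSpace ℝ (Fin (d + 1))) (n := d)).comp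
    contMDiff_snd)

/-- The blow-down map read in a chart of `ℝ × S^{n−1}` is smooth. -/
theorem contDiffOn_blowDown_extChartAt_symm
    (z : ℝ × Metric.sphere (0 : EuclideanSpace ℝ (Fin (d + 1))) 1) :
    ContDiffOn ℝ ∞ (blowDown d ∘ (extChartAt ((𝓘(ℝ, ℝ)).prod (𝓡 d)) z).symm)
      (extChartAt ((𝓘(ℝ, ℝ)).prod (𝓡 d)) z).target :=
  contMDiffOn_iff_contDiffOn.1
    (contMDiff_blowDown.comp_contMDiffOn (contMDiffOn_extChartAt_symm z))

theorem mFlatAt_iff_flatAt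
    {f : ℝ × Metric.sphere (0 : EuclideanSpace ℝ (Fin (d + 1))) 1 → ℝ}
    {D : Set (ℝ × Metric.sphere (0 : EuclideanSpace ℝ (Fin (d + 1))) 1)} (hD : IsOpen D)
    {z : ℝ × Metric.sphere (0 : EuclideanSpace ℝ (Fin (d + 1))) 1} (hz : z ∈ D) :
    MFlatAt d f D z ↔ FlatAt (f ∘ (extChartAt ((𝓘(ℝ, ℝ)).prod (𝓡 d)) z).symm)
      (extChartAt ((𝓘(ℝ, ℝ)).prod (𝓡 d)) z z) := by
  have hopen := (continuousOn_extChartAt_symm (I := (𝓘(ℝ, ℝ)).prod (𝓡 d)) z).isOpen_inter_preimage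
    (isOpen_extChartAt_target z) hD
  refine forall_congr' fun k => ?_
  rw [iteratedFDerivWithin_of_isOpen k hopen]
  refine ⟨mem_extChartAt_target z, ?_⟩
  rwa [Set.mem_preimage, extChartAt_to_inv]

/-- The line `t ↦ (t, u)`, read in the chart at `(0, u)`. -/
theorem extChartAt_symm_line (u : Metric.sphere (0 : EuclideanSpace ℝ (Fin (d + 1))) 1) (t : ℝ) :
    (extChartAt ((𝓘(ℝ, ℝ)).prod (𝓡 d)) ((0 : ℝ), u)).symm (t, extChartAt (𝓡 d) u u) = (t, u) := by
  rw [extChartAt_prod, PartialEquiv.prod_coe_symm]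
  exact Prod.ext rfl (extChartAt_to_inv (I := 𝓡 d) u)

/-- A smooth function is flat at the origin iff its pull-back by the blow-down map is flat along
the exceptional set. -/
theorem flatAt_zero_iff_forall_mFlatAt {U : Set (EuclideanSpace ℝ (Fin (d + 1)))} (hU : IsOpen U)
    (h0U : (0 : EuclideanSpace ℝ (Fin (d + 1))) ∈ U)
    {g : EuclideanSpace ℝ (Fin (d + 1)) → ℝ} (hg : ContDiffOn ℝ ∞ g U) :
    FlatAt g 0 ↔ ∀ u : Metric.sphere (0 : EuclideanSpace ℝ (Fin (d + 1))) 1,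
      MFlatAt d (fun z => g (blowDown d z)) {z | blowDown d z ∈ U} (0, u) := by
  have hD : IsOpen {z | blowDown d z ∈ U} := hU.preimage contMDiff_blowDown.continuous
  have hb (u : Metric.sphere (0 : EuclideanSpace ℝ (Fin (d + 1))) 1) :
      blowDown d (0, u) = 0 := zero_smul _ _
  have hg0 : ContDiffAt ℝ ∞ g 0 := hg.contDiffAt (hU.mem_nhds h0U)
  have hmem (u : Metric.sphere (0 : EuclideanSpace ℝ (Fin (d + 1))) 1) :
      ((0 : ℝ), u) ∈ {z | blowDown d z ∈ U} := by
    rwa [Set.mem_ofPred_eq, hb]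
  have hchart (u : Metric.sphere (0 : EuclideanSpace ℝ (Fin (d + 1))) 1) :
      ContDiffAt ℝ ∞ (blowDown d ∘ (extChartAt ((𝓘(ℝ, ℝ)).prod (𝓡 d)) ((0 : ℝ), u)).symm)
        (extChartAt ((𝓘(ℝ, ℝ)).prod (𝓡 d)) ((0 : ℝ), u) (0, u)) :=
    (contDiffOn_blowDown_extChartAt_symm _).contDiffAt (extChartAt_target_mem_nhds _)
  have hval (u : Metric.sphere (0 : EuclideanSpace ℝ (Fin (d + 1))) 1) :
      (blowDown d ∘ (extChartAt ((𝓘(ℝ, ℝ)).prod (𝓡 d)) ((0 : ℝ), u)).symm)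
        (extChartAt ((𝓘(ℝ, ℝ)).prod (𝓡 d)) ((0 : ℝ), u) (0, u)) = 0 := by
    rw [Function.comp_apply, extChartAt_to_inv, hb]
  constructor
  · intro h u
    rw [mFlatAt_iff_flatAt hD (hmem u)]
    exact h.comp (hval u) hg0 (hchart u)
  · intro h
    refine flatAt_zero_of_forall_line hU h0U hg fun u hu => ?_
    let u' : Metric.sphere (0 : EuclideanSpace ℝ (Fin (d + 1))) 1 :=
      ⟨u, mem_sphere_zero_iff_norm.2 hu⟩
    have hflat := (mFlatAt_iff_flatAt hD (hmem u')).1 (h u')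
    let γ : ℝ → ℝ × EuclideanSpace ℝ (Fin d) := fun t => (t, extChartAt (𝓡 d) u' u')
    have hγ : ContDiffAt ℝ ∞ γ 0 := contDiffAt_id.prodMk contDiffAt_const
    have hγ0 : γ 0 = extChartAt ((𝓘(ℝ, ℝ)).prod (𝓡 d)) ((0 : ℝ), u') (0, u') := by
      rw [extChartAt_prod]
      rfl
    have hsm := ContDiffAt.comp _ (g := g) (by rwa [hval]) (hchart u')
    have hline := hflat.comp hγ0 hsm hγ
    convert hline using 1
    funext t
    simp only [Function.comp_apply, γ]
    rw [extChartAt_symm_line]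
    rfl

end BlowDown

/-- a smooth function `G` on a neighborhood `U` of `0 ∈ ℝⁿ` (`n = d+1 ≥ 1`)
is flat at `0` if and only if its pull-back `G̃ = G ∘ p` by the polar blow-down map
`p : ℝ × S^{n−1} → ℝⁿ`, `p(t,u) = t·u`, is flat at every point of the exceptional set
`{0} × S^{n−1}`; and the same equivalence holds componentwise for a smooth vector field
`Z` on `U`. -/
theorem flat_iff_blowup_flat (d : ℕ)
    (U : Set (EuclideanSpace ℝ (Fin (d + 1)))) (hU : IsOpen U)
    (h0U : (0 : EuclideanSpace ℝ (Fin (d + 1))) ∈ U)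
    (G : EuclideanSpace ℝ (Fin (d + 1)) → ℝ) (hG : ContDiffOn ℝ ∞ G U)
    (Z : EuclideanSpace ℝ (Fin (d + 1)) → EuclideanSpace ℝ (Fin (d + 1)))
    (hZ : ContDiffOn ℝ ∞ Z U) :
    (FlatAt G 0 ↔
      ∀ u : Metric.sphere (0 : EuclideanSpace ℝ (Fin (d + 1))) 1,
        MFlatAt d (fun z => G (blowDown d z)) {z | blowDown d z ∈ U} (0, u)) ∧
    (FlatAt Z 0 ↔
      ∀ u : Metric.sphere (0 : EuclideanSpace ℝ (Fin (d + 1))) 1,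
        ∀ j : Fin (d + 1),
          MFlatAt d (fun z => Z (blowDown d z) j) {z | blowDown d z ∈ U} (0, u)) := by
  refine ⟨flatAt_zero_iff_forall_mFlatAt hU h0U hG, ?_⟩
  rw [flatAt_euclidean_iff (hZ.contDiffAt (hU.mem_nhds h0U)), forall_comm]
  exact forall_congr' fun j => flatAt_zero_iff_forall_mFlatAt hU h0U
    ((EuclideanSpace.proj (𝕜 := ℝ) j).contDiff.comp_contDiffOn hZ)
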